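/- Let f ∈ ℝ[z_1,…,z_n] be homogeneous of degree d ≥ 2 with nonnegative coefficients, let a ∈ ℝ_{≥0}^n with f(a) ≠ 0, and let Q = ∇²f(a) be the Hessian matrix of f at a. Then f is log-concave at a if and only if the matrix (aᵀQa)·Q − (Qa)(Qa)ᵀ is negative semidefinite. -/

import Mathlib

open Matrix MvPolynomial

/-- The Hessian matrix `∇²f(a)` of `f` at the point `a`. -/
noncomputable def hessAt {m : ℕ} (f : MvPolynomial (Fin m) ℝ) (a : Fin m → ℝ) :
    Matrix (Fin m) (Fin m) ℝ :=
  fun i j => MvPolynomial.eval a (MvPolynomial.pderiv i (MvPolynomial.pderiv j f))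

/-- The Hessian of `log f` at `a`, namely `(f(a)·∇²f(a) − ∇f(a)·∇f(a)ᵀ) / f(a)²`. -/
noncomputable def logHessAt {m : ℕ} (f : MvPolynomial (Fin m) ℝ) (a : Fin m → ℝ) :
    Matrix (Fin m) (Fin m) ℝ :=
  fun i j =>
    (MvPolynomial.eval a f * hessAt f a i j -
        MvPolynomial.eval a (MvPolynomial.pderiv i f) *
          MvPolynomial.eval a (MvPolynomial.pderiv j f)) /
      (MvPolynomial.eval a f) ^ 2

/-- A matrix `N` is negative semidefinite if `xᵀNx ≤ 0` for all `x`. -/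
def IsNegSemidef {m : ℕ} (N : Matrix (Fin m) (Fin m) ℝ) : Prop :=
  ∀ x : Fin m → ℝ, x ⬝ᵥ (N *ᵥ x) ≤ 0

/-- `f` is log-concave at the point `a`: the Hessian of `log f` at `a` is
negative semidefinite. -/
def LogConcaveAt {m : ℕ} (f : MvPolynomial (Fin m) ℝ) (a : Fin m → ℝ) : Prop :=
  IsNegSemidef (logHessAt f a)

/-- Euler's identity, evaluated at a point. -/
theorem MvPolynomial.IsHomogeneous.sum_mul_eval_pderiv {n d : ℕ} {f : MvPolynomial (Fin n) ℝ}
    (hf : f.IsHomogeneous d) (a : Fin n → ℝ) :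
    ∑ i, a i * eval a (pderiv i f) = d * eval a f := by
  simpa using congrArg (eval a) hf.sum_X_mul_pderiv

/-- Partial derivatives commute. -/
theorem MvPolynomial.pderiv_pderiv_comm {σ R : Type*} [CommRing R] (i j : σ)
    (f : MvPolynomial σ R) : pderiv i (pderiv j f) = pderiv j (pderiv i f) := by
  classical
  have h : ⁅(pderiv i : Derivation R (MvPolynomial σ R) (MvPolynomial σ R)),
      (pderiv j : Derivation R (MvPolynomial σ R) (MvPolynomial σ R))⁆ = 0 := by
    refine derivation_ext fun k => ?_
    rw [Derivation.commutator_apply, pderiv_X, pderiv_X, Pi.single_apply, Pi.single_apply]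
    split_ifs <;> simp
  have hf := DFunLike.congr_fun h f
  rwa [Derivation.commutator_apply, Derivation.zero_apply, sub_eq_zero] at hf

/-- The Hessian is symmetric. -/
theorem hessAt_isSymm {n : ℕ} (f : MvPolynomial (Fin n) ℝ) (a : Fin n → ℝ) :
    (hessAt f a).IsSymm := by
  ext i j
  exact congrArg (eval a) (pderiv_pderiv_comm j i f)

/-- Euler's identity for the gradient: `∇²f(a) a = (d - 1) ∇f(a)`. -/
theorem hessAt_mulVec_self {n d : ℕ} (hd : 1 ≤ d) {f : MvPolynomial (Fin n) ℝ}
    (hf : f.IsHomogeneous d) (a : Fin n → ℝ) :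
    hessAt f a *ᵥ a = ((d : ℝ) - 1) • fun i => eval a (pderiv i f) := by
  rw [← (hessAt_isSymm f a).eq]
  ext j
  have h := (hf.pderiv (i := j)).sum_mul_eval_pderiv a
  rw [Nat.cast_sub hd, Nat.cast_one] at h
  simpa [Matrix.mulVec, dotProduct, hessAt, mul_comm] using h

theorem logHessAt_eq {n : ℕ} (f : MvPolynomial (Fin n) ℝ) (a : Fin n → ℝ) :
    logHessAt f a = ((eval a f) ^ 2)⁻¹ • (eval a f • hessAt f a -
      vecMulVec (fun i => eval a (pderiv i f)) (fun i => eval a (pderiv i f))) := by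
  ext i j
  simp [logHessAt, vecMulVec_apply, div_eq_inv_mul]

theorem dotProduct_smul_sub_vecMulVec_mulVec {n : ℕ} (c : ℝ) (Q : Matrix (Fin n) (Fin n) ℝ)
    (g x : Fin n → ℝ) :
    x ⬝ᵥ ((c • Q - vecMulVec g g) *ᵥ x) = c * (x ⬝ᵥ (Q *ᵥ x)) - (g ⬝ᵥ x) ^ 2 := by
  simp only [sub_mulVec, smul_mulVec, vecMulVec_mulVec, dotProduct_sub, dotProduct_smul,
    op_smul_eq_smul, smul_eq_mul, dotProduct_comm x g]
  ring

theorem isNegSemidef_smul_iff {n : ℕ} {c : ℝ} (hc : 0 < c) (N : Matrix (Fin n) (Fin n) ℝ) :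
    IsNegSemidef (c • N) ↔ IsNegSemidef N := by
  refine forall_congr' fun x => ?_
  rw [smul_mulVec, dotProduct_smul, smul_nonpos_iff_nonpos_of_pos_left hc]

theorem eval_nonneg_of_coeff_nonneg {n : ℕ} {f : MvPolynomial (Fin n) ℝ}
    (hf : ∀ m, 0 ≤ f.coeff m) {a : Fin n → ℝ} (ha : ∀ i, 0 ≤ a i) : 0 ≤ eval a f := by
  rw [eval_eq]
  exact Finset.sum_nonneg fun m _ =>
    mul_nonneg (hf m) (Finset.prod_nonneg fun i _ => pow_nonneg (ha i) _)

/-- If `Q a = (d - 1) g` and `g ⬝ᵥ a = d F`, then `F Q - g gᵀ` and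
`(aᵀQa) Q - (Qa)(Qa)ᵀ` are negative semidefinite simultaneously: both reduce to the sign of `Q`
on the hyperplane `g ⬝ᵥ y = 0`. -/
theorem isNegSemidef_smul_sub_vecMulVec_iff {n : ℕ} {d F : ℝ} (hd : 1 < d) (hF : 0 < F)
    {Q : Matrix (Fin n) (Fin n) ℝ} (hQ : Q.IsSymm) {a g : Fin n → ℝ}
    (hQa : Q *ᵥ a = (d - 1) • g) (hga : g ⬝ᵥ a = d * F) :
    IsNegSemidef (F • Q - vecMulVec g g) ↔
      IsNegSemidef ((a ⬝ᵥ (Q *ᵥ a)) • Q - vecMulVec (Q *ᵥ a) (Q *ᵥ a)) := by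
  have hd' : 0 < d - 1 := by linarith
  have haQa : a ⬝ᵥ (Q *ᵥ a) = (d - 1) * (d * F) := by
    rw [hQa, dotProduct_smul, dotProduct_comm, hga, smul_eq_mul]
  simp only [IsNegSemidef, dotProduct_smul_sub_vecMulVec_mulVec, haQa]
  simp only [hQa, smul_dotProduct, smul_eq_mul]
  constructor
  · intro h x
    have hxQa : x ⬝ᵥ (Q *ᵥ a) = (d - 1) * (g ⬝ᵥ x) := by
      rw [hQa, dotProduct_smul, dotProduct_comm, smul_eq_mul]
    have haQx : a ⬝ᵥ (Q *ᵥ x) = (d - 1) * (g ⬝ᵥ x) := by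
      rw [← hxQa, dotProduct_mulVec, ← mulVec_transpose, hQ.eq, dotProduct_comm]
    have hy := h ((d * F) • x - (g ⬝ᵥ x) • a)
    simp only [mulVec_sub, mulVec_smul, dotProduct_sub, sub_dotProduct, smul_dotProduct,
      dotProduct_smul, smul_eq_mul, haQx, hxQa, haQa, hga] at hy
    have key : (d * F ^ 2) * (d * F * (x ⬝ᵥ (Q *ᵥ x)) - (d - 1) * (g ⬝ᵥ x) ^ 2) ≤ 0 := by
      linarith
    have hx := (smul_nonpos_iff_nonpos_of_pos_left (show 0 < d * F ^ 2 by positivity)).1 key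
    nlinarith [mul_nonpos_of_nonneg_of_nonpos hd'.le hx]
  · intro h x
    have key : (d - 1) * (d * F * (x ⬝ᵥ (Q *ᵥ x)) - (d - 1) * (g ⬝ᵥ x) ^ 2) ≤ 0 := by
      linarith [h x]
    have h1 := (smul_nonpos_iff_nonpos_of_pos_left hd').1 key
    refine (smul_nonpos_iff_nonpos_of_pos_left (show 0 < d by linarith)).1 ?_
    rw [smul_eq_mul]
    nlinarith [sq_nonneg (g ⬝ᵥ x)]

/-- Let `f` be homogeneous of degree `d ≥ 2` with nonnegative coefficients,
`a ∈ ℝ_{≥0}^n` with `f(a) ≠ 0`, and `Q = ∇²f(a)`. Then `f` is log-concave at `a` iff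
the matrix `(aᵀQa)·Q − (Qa)(Qa)ᵀ` is negative semidefinite. -/
theorem logConcaveAt_iff_negSemidef_matrix {n d : ℕ} (hd : 2 ≤ d)
    (f : MvPolynomial (Fin n) ℝ)
    (hhom : f.IsHomogeneous d) (hcoeff : ∀ m, 0 ≤ f.coeff m)
    (a : Fin n → ℝ) (ha : ∀ i, 0 ≤ a i) (hfa : MvPolynomial.eval a f ≠ 0) :
    LogConcaveAt f a ↔
      IsNegSemidef ((a ⬝ᵥ (hessAt f a *ᵥ a)) • hessAt f a -
        Matrix.vecMulVec (hessAt f a *ᵥ a) (hessAt f a *ᵥ a)) := by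
  have hF : 0 < eval a f := lt_of_le_of_ne (eval_nonneg_of_coeff_nonneg hcoeff ha) hfa.symm
  rw [LogConcaveAt, logHessAt_eq, isNegSemidef_smul_iff (by positivity)]
  refine isNegSemidef_smul_sub_vecMulVec_iff (d := d) (by exact_mod_cast hd) hF
    (hessAt_isSymm f a) (hessAt_mulVec_self (by lia) hhom a) ?_
  rw [dotProduct_comm]
  exact hhom.sum_mul_eval_pderiv a
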